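/- Let τ be an indeterminate. For all integers L, p, k with p ≥ 2, k ≥ 1 and L − 2p − k ≥ 1, the following bilinear recurrence holds in ℤ[τ]: T(L,p,k)·T(L−2,p−2,k+2) = T(L−1,p−2,k+2)·T(L−1,p,k) + τ²·T(L−2,p−1,k)·T(L,p−1,k+2). -/

import Mathlib

open Polynomial Finset

/-- Binomial coefficient `C(a,b)` for integer arguments, equal to `0` if `b < 0` or `b > a`
    (for `a ≥ 0`). -/
def intChoose (a b : ℤ) : ℤ := if 0 ≤ b then (a.toNat.choose b.toNat : ℤ) else 0

/-- `T(L,p,k)`: the determinant of the `p × p` matrix whose `(ℓ,m)` entry (`1 ≤ ℓ, m ≤ p`) is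
    `∑_{r=0}^{2p} C(ℓ+k-1, r-ℓ) C(m+L-2p-k, 2m-r) τ^{2(2m-r)}`, as a polynomial in `τ`. -/
noncomputable def Tpoly (L p k : ℤ) : Polynomial ℤ :=
  Matrix.det (Matrix.of fun ℓ m : Fin p.toNat =>
    ∑ r ∈ Finset.range (2 * p.toNat + 1),
      Polynomial.C (intChoose ((ℓ : ℤ) + 1 + k - 1) ((r : ℤ) - ((ℓ : ℤ) + 1)) *
          intChoose (((m : ℤ) + 1) + L - 2 * p - k) (2 * ((m : ℤ) + 1) - (r : ℤ))) *
        Polynomial.X ^ (2 * (2 * ((m : ℤ) + 1) - (r : ℤ))).toNat)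

namespace Matrix

variable {R : Type*} [CommRing R]

/-- Jacobi's complementary minor identity, before cancelling a power of the determinant. -/
theorem det_mul_det_adjugate_toBlocks₁₁ {m n : Type*} [Fintype m] [Fintype n] [DecidableEq m]
    [DecidableEq n] (M : Matrix (m ⊕ n) (m ⊕ n) R) :
    M.det * M.adjugate.toBlocks₁₁.det = M.det ^ Fintype.card m * M.toBlocks₂₂.det := by
  have h := mul_adjugate M
  rw [← fromBlocks_toBlocks M.adjugate] at h
  nth_rw 1 [← fromBlocks_toBlocks M] at h
  rw [fromBlocks_multiply, ← fromBlocks_one, fromBlocks_smul, fromBlocks_inj] at h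
  obtain ⟨h₁, -, h₂, -⟩ := h
  have key : M * fromBlocks M.adjugate.toBlocks₁₁ 0 M.adjugate.toBlocks₂₁ 1 =
      fromBlocks (M.det • 1) M.toBlocks₁₂ 0 M.toBlocks₂₂ := by
    nth_rw 1 [← fromBlocks_toBlocks M]
    rw [fromBlocks_multiply, h₁, h₂]
    simp
  have := congrArg det key
  rw [det_mul, det_fromBlocks_zero₁₂, det_fromBlocks_zero₂₁, det_one, mul_one, det_smul,
    det_one, mul_one] at this
  exact this

theorem det_adjugate_toBlocks₁₁_fin_two {n : Type*} [Fintype n] [DecidableEq n]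
    (M : Matrix (Fin 2 ⊕ n) (Fin 2 ⊕ n) R) :
    M.adjugate.toBlocks₁₁.det = M.det * M.toBlocks₂₂.det := by
  let f : MvPolynomial ((Fin 2 ⊕ n) × (Fin 2 ⊕ n)) ℤ →+* R :=
    MvPolynomial.eval₂Hom (Int.castRingHom R) fun p => M p.1 p.2
  let G := mvPolynomialX (Fin 2 ⊕ n) (Fin 2 ⊕ n) ℤ
  have hM : f.mapMatrix G = M := mvPolynomialX_map_eval₂ _ M
  have hG : G.adjugate.toBlocks₁₁.det = G.det * G.toBlocks₂₂.det := by
    apply mul_left_cancel₀ (det_mvPolynomialX_ne_zero (Fin 2 ⊕ n) ℤ)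
    rw [det_mul_det_adjugate_toBlocks₁₁, Fintype.card_fin]
    ring
  have := congrArg f hG
  rw [map_mul, RingHom.map_det, RingHom.map_det, RingHom.map_det, hM] at this
  have h₁ : f.mapMatrix G.adjugate.toBlocks₁₁ = M.adjugate.toBlocks₁₁ := by
    rw [← hM, ← RingHom.map_adjugate]
    rfl
  have h₂ : f.mapMatrix G.toBlocks₂₂ = M.toBlocks₂₂ := by
    rw [← hM]
    rfl
  rwa [h₁, h₂] at this

/-- The Desnanot–Jacobi identity (Dodgson condensation). -/
theorem desnanot_jacobi {q : ℕ} (M : Matrix (Fin (q + 2)) (Fin (q + 2)) R) :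
    M.det * (M.submatrix (fun i : Fin q => i.succ.castSucc) fun i => i.succ.castSucc).det =
      (M.submatrix Fin.succ Fin.succ).det * (M.submatrix Fin.castSucc Fin.castSucc).det -
        (M.submatrix Fin.succ Fin.castSucc).det * (M.submatrix Fin.castSucc Fin.succ).det := by
  let g : Fin 2 ⊕ Fin q → Fin (q + 2) :=
    Sum.elim ![0, Fin.last (q + 1)] fun i => i.succ.castSucc
  have hg : Function.Bijective g := by
    rw [Fintype.bijective_iff_injective_and_card]
    refine ⟨?_, by simp [add_comm]⟩
    rintro (i | i) (j | j) h
    · fin_cases i <;> fin_cases j <;> simp_all [g, Fin.ext_iff]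
    · fin_cases i <;> simp [g, Fin.ext_iff] at h
      omega
    · fin_cases j <;> simp [g, Fin.ext_iff] at h
      omega
    · simpa [g] using h
  let e := Equiv.ofBijective g hg
  have h := det_adjugate_toBlocks₁₁_fin_two (M.submatrix e e)
  rw [adjugate_submatrix_equiv_self, det_submatrix_equiv_self, det_fin_two] at h
  simp only [toBlocks₁₁, of_apply, submatrix_apply, adjugate_fin_succ_eq_det_submatrix] at h
  have e0 : e (Sum.inl 0) = 0 := rfl
  have e1 : e (Sum.inl 1) = Fin.last (q + 1) := rfl
  rw [e0, e1, Fin.succAbove_last, Fin.succAbove_zero] at h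
  have h2 : (M.submatrix e e).toBlocks₂₂ =
    M.submatrix (fun i : Fin q => i.succ.castSucc) fun i => i.succ.castSucc := rfl
  rw [h2] at h
  rw [← h]
  have hs : ((-1 : R) ^ (q + 1)) * (-1) ^ (q + 1) = 1 := by
    rw [← mul_pow]; simp
  simp only [Fin.val_zero, Fin.val_last, pow_add, pow_zero] at hs ⊢
  linear_combination ((M.submatrix Fin.succ Fin.succ).det *
    (M.submatrix Fin.castSucc Fin.castSucc).det - (M.submatrix Fin.succ Fin.castSucc).det *
    (M.submatrix Fin.castSucc Fin.succ).det) * hs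

/-- Adding to each row a multiple of the next one does not change the determinant. -/
theorem det_of_add_mul_succ_row {p : ℕ} (m : ℕ → Fin (p + 1) → R) (c : ℕ → R) :
    (of fun i j : Fin (p + 1) => m i j).det =
      (of fun i j : Fin (p + 1) =>
        m i j + if (i : ℕ) < p then c i * m (i + 1) j else 0).det := by
  rw [← det_submatrix_equiv_self Fin.revPerm, eq_comm,
    ← det_submatrix_equiv_self Fin.revPerm, eq_comm]
  refine det_eq_of_forall_row_eq_smul_add_pred (fun i => -c (p - (i + 1))) ?_ ?_
  · intro j
    simp
  · intro i j
    have h₁ : p - (i + 1 : ℕ) < p := by omega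
    have h₂ : p - (i + 1 : ℕ) + 1 = p - i := by omega
    simp [Fin.val_rev, h₁, h₂]

/-- A determinant whose first column `e` is killed by adding to each row a multiple of the next. -/
theorem det_cons_column {p : ℕ} (h : ℕ → Fin p → R) (e c : ℕ → R)
    (he : ∀ i < p, e i + c i * e (i + 1) = 0) :
    (of fun i j : Fin (p + 1) => (Fin.cons (e i) (h i) : Fin (p + 1) → R) j).det =
      (-1) ^ p * e p * (of fun i j : Fin p => h i j + c i * h (i + 1) j).det := by
  rw [det_of_add_mul_succ_row (fun i => Fin.cons (e i) (h i)) c, det_succ_column_zero,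
    Finset.sum_eq_single (Fin.last p)]
  · congr 2
    · simp
    · ext i j
      simp
  · intro i _ hi
    have : (i : ℕ) < p := Fin.val_lt_last hi
    simp [this, he]
  · simp

/-- Elimination of a first column with entries `f 0 0, 1, 0, …, 0`. -/
theorem det_eliminate_first_column {p : ℕ} {f g : ℕ → ℕ → R} (h₁ : f 1 0 = 1)
    (h₂ : ∀ i, f (i + 2) 0 = 0) (hg₀ : ∀ j, g 0 j = f 0 (j + 1) - f 0 0 * f 1 (j + 1))
    (hg : ∀ i j, g (i + 1) j = f (i + 2) (j + 1)) :
    (of fun i j : Fin (p + 2) => f i j).det = -(of fun i j : Fin (p + 1) => g i j).det := by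
  rw [← det_updateRow_add_smul_self _ (zero_ne_one : (0 : Fin (p + 2)) ≠ 1) (-f 0 0),
    det_succ_column_zero, Finset.sum_eq_single 1]
  · rw [updateRow_ne one_ne_zero]
    have : ((updateRow (of fun i j : Fin (p + 2) => f i j) 0
        ((of fun i j : Fin (p + 2) => f i j) 0 +
          -f 0 0 • (of fun i j : Fin (p + 2) => f i j) 1)).submatrix
        (Fin.succAbove 1) Fin.succ) = of fun i j : Fin (p + 1) => g i j := by
      ext i j
      refine Fin.cases ?_ (fun i => ?_) i
      · simp [hg₀]
        ring
      · have h : Fin.succAbove (1 : Fin (p + 2)) i.succ = i.succ.succ := by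
          rw [← Fin.succ_zero_eq_one, Fin.succ_succAbove_succ, Fin.succAbove_zero]
        simp [h, hg, updateRow_apply]
    rw [this]
    simp [h₁]
  · intro i _ hi
    induction i using Fin.cases with
    | zero => simp [h₁]
    | succ i =>
      induction i using Fin.cases with
      | zero => simp at hi
      | succ i => simp [h₂, updateRow_apply]
  · simp

end Matrix

section Entries

variable {R : Type*} [CommRing R]

/-- The `(i, j)` entry of the matrix defining `Tpoly` in zero-based indices, written as a
coefficient of a product of binomial powers; `t` plays the role of `τ²`. -/
noncomputable def binomialEntry (t : R) (κ n i j : ℕ) : R :=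
  ((X ^ (i + 1) * (1 + X) ^ (i + 1 + κ) * (1 + C t * X) ^ (j + 1 + n) : R[X])).coeff
    (2 * (j + 1))

variable (t : R) (κ n : ℕ)

theorem binomialEntry_shift (i j : ℕ) :
    binomialEntry t (κ + 2) (n + 1) i j = binomialEntry t κ n (i + 2) (j + 1) := by
  unfold binomialEntry
  rw [show (X ^ (i + 2 + 1) * (1 + X) ^ (i + 2 + 1 + κ) * (1 + C t * X) ^ (j + 1 + 1 + n) : R[X]) =
    X ^ (i + 1) * (1 + X) ^ (i + 1 + (κ + 2)) * (1 + C t * X) ^ (j + 1 + (n + 1)) * X ^ 2 by ring,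
    show 2 * (j + 1 + 1) = 2 * (j + 1) + 2 by ring, coeff_mul_X_pow]

theorem binomialEntry_recurrence (i j : ℕ) :
    binomialEntry t κ (n + 1) i (j + 1) + t * binomialEntry t κ (n + 1) i j =
      binomialEntry t κ n i (j + 1) + t * binomialEntry t κ n (i + 1) (j + 1) := by
  unfold binomialEntry
  rw [← coeff_mul_X_pow (X ^ (i + 1) * _ * (1 + C t * X) ^ (j + 1 + (n + 1))) 2,
    show 2 * (j + 1) + 2 = 2 * (j + 1 + 1) by ring, ← coeff_C_mul,
    ← coeff_C_mul, ← coeff_add, ← coeff_add]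
  congr 1
  ring

theorem binomialEntry_zero_of_two_le {i : ℕ} (hi : 2 ≤ i) : binomialEntry t κ n i 0 = 0 := by
  unfold binomialEntry
  rw [mul_assoc, coeff_X_pow_mul', if_neg (by omega)]

theorem binomialEntry_one_zero : binomialEntry t κ n 1 0 = 1 := by
  unfold binomialEntry
  rw [mul_assoc, coeff_X_pow_mul']
  simp [coeff_zero_eq_eval_zero]

theorem binomialEntry_succ_zero (i : ℕ) :
    binomialEntry t κ (n + 1) i 0 =
      binomialEntry t κ n i 0 + t * binomialEntry t κ n (i + 1) 0 := by
  have h : (C t * (X ^ (i + 1) * (1 + X) ^ (i + 1 + κ) * (1 + C t * X) ^ (0 + 1 + n) * X ^ 2) :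
      R[X]).coeff (2 * (0 + 1)) = 0 := by
    rw [coeff_C_mul, coeff_mul_X_pow', if_pos (by norm_num), mul_assoc, coeff_X_pow_mul',
      if_neg (by omega), mul_zero]
  unfold binomialEntry
  rw [← coeff_C_mul, ← coeff_add, ← add_zero (coeff _ _), ← h, ← coeff_add]
  congr 1
  ring

/-- The `p × p` determinant with entries `binomialEntry`. -/
noncomputable def binomialDet (t : R) (κ n p : ℕ) : R :=
  (Matrix.of fun i j : Fin p => binomialEntry t κ n i j).det

theorem det_eq_of_col_recurrence {p : ℕ} {a c : ℕ → ℕ → R}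
    (h0 : ∀ i, c i 0 = a i 0) (hs : ∀ i j, c i (j + 1) + t * c i j = a i (j + 1)) :
    (Matrix.of fun i j : Fin p => c i j).det = (Matrix.of fun i j : Fin p => a i j).det := by
  cases p with
  | zero => simp
  | succ p =>
    refine Matrix.det_eq_of_forall_col_eq_smul_add_pred (fun _ => -t) ?_ ?_
    · intro i
      simp [h0]
    · intro i j
      simp [← hs]

theorem binomialDet_succ (p : ℕ) :
    binomialDet t κ (n + 1) p = (Matrix.of fun i j : Fin p =>
      binomialEntry t κ n i j + t * binomialEntry t κ n (i + 1) j).det :=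
  det_eq_of_col_recurrence t (a := fun i j => binomialEntry t κ n i j +
    t * binomialEntry t κ n (i + 1) j) (fun i => binomialEntry_succ_zero t κ n i)
    fun i j => binomialEntry_recurrence t κ n i j

theorem binomialDet_add_two_succ (p : ℕ) :
    binomialDet t (κ + 2) (n + 1) p =
      (Matrix.of fun i j : Fin p => binomialEntry t κ n (i + 2) (j + 1)).det := by
  simp only [binomialDet, binomialEntry_shift]

theorem binomialDet_add_two_add_two (p : ℕ) :
    binomialDet t (κ + 2) (n + 2) p = (Matrix.of fun i j : Fin p =>
      binomialEntry t κ n (i + 2) (j + 1) + t * binomialEntry t κ n (i + 3) (j + 1)).det := by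
  rw [binomialDet_add_two_succ]
  refine det_eq_of_col_recurrence t
    (c := fun i j => binomialEntry t κ (n + 1) (i + 2) (j + 1))
    (a := fun i j => binomialEntry t κ n (i + 2) (j + 1) +
      t * binomialEntry t κ n (i + 3) (j + 1)) (fun i => ?_)
    fun i j => binomialEntry_recurrence t κ n (i + 2) (j + 1)
  have := binomialEntry_recurrence t κ n (i + 2) 0
  rwa [binomialEntry_zero_of_two_le _ _ _ (by omega), mul_zero, add_zero] at this

theorem binomialDet_bilinear_recurrence (q : ℕ) :
    binomialDet t κ (n + 1) (q + 2) * binomialDet t (κ + 2) (n + 1) q =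
      binomialDet t (κ + 2) (n + 2) q * binomialDet t κ n (q + 2) +
        t * (binomialDet t κ (n + 1) (q + 1) * binomialDet t (κ + 2) (n + 1) (q + 1)) := by
  let a := binomialEntry t κ n
  let h : ℕ → ℕ → R := fun i j =>
    Nat.casesOn i (a 0 (j + 1) - a 0 0 * a 1 (j + 1)) fun i => a (i + 2) (j + 1)
  let c : ℕ → R := fun i => Nat.casesOn i (-t * (a 0 0 + t)) fun _ => t
  let e : ℕ → R := fun i => Nat.casesOn i (t * (a 0 0 + t) * (-t) ^ q) fun i => (-t) ^ (q - i)
  have a10 : a 1 0 = 1 := binomialEntry_one_zero t κ n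
  have a0 (i : ℕ) : a (i + 2) 0 = 0 := binomialEntry_zero_of_two_le t κ n (by omega)
  have he (i : ℕ) (hi : i < q + 1) : e i + c i * e (i + 1) = 0 := by
    cases i with
    | zero => simp [e, c]
    | succ i =>
      have : q - i = q - (i + 1) + 1 := by omega
      simp only [e, c, this, pow_succ]
      ring
  have hrec (p : ℕ) : binomialDet t κ (n + 1) (p + 2) =
      -(Matrix.of fun i j : Fin (p + 1) => h i j + c i * h (i + 1) j).det := by
    rw [binomialDet_succ]
    refine Matrix.det_eliminate_first_column (f := fun i j => a i j + t * a (i + 1) j)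
      (g := fun i j => h i j + c i * h (i + 1) j) ?_ ?_ ?_ ?_
    · simp [a10, a0]
    · simp [a0]
    · intro j
      change a 0 (j + 1) - a 0 0 * a 1 (j + 1) + -t * (a 0 0 + t) * a 2 (j + 1) =
        a 0 (j + 1) + t * a 1 (j + 1) - (a 0 0 + t * a 1 0) * (a 1 (j + 1) + t * a 2 (j + 1))
      rw [a10]
      ring
    · intro i j
      rfl
  let M : Matrix (Fin (q + 2)) (Fin (q + 2)) R :=
    Matrix.of fun i j => (Fin.cons (e i) (fun j : Fin (q + 1) => h i j) : Fin (q + 2) → R) j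
  have d₁ : M.det = (-1) ^ q * binomialDet t κ (n + 1) (q + 2) := by
    rw [hrec]
    refine (Matrix.det_cons_column (fun i (j : Fin (q + 1)) => h i j) e c he).trans ?_
    simp [e, pow_succ]
  have d₂ : (M.submatrix (fun i : Fin q => i.succ.castSucc) fun i => i.succ.castSucc).det =
      binomialDet t (κ + 2) (n + 1) q := by
    rw [binomialDet_add_two_succ]
    rfl
  have d₃ : (M.submatrix Fin.succ Fin.succ).det = binomialDet t (κ + 2) (n + 1) (q + 1) := by
    rw [binomialDet_add_two_succ]
    rfl
  have hcons (i : ℕ) : (fun j : Fin (q + 1) =>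
      (Fin.cons (e i) (fun j : Fin (q + 1) => h i j) : Fin (q + 2) → R) j.castSucc) =
      Fin.cons (e i) fun j : Fin q => h i j := by
    ext j
    refine Fin.cases rfl (fun j => rfl) j
  have d₄ : (M.submatrix Fin.castSucc Fin.castSucc).det =
      (-1) ^ q * (t * binomialDet t κ (n + 1) (q + 1)) := by
    have hM : M.submatrix Fin.castSucc Fin.castSucc = Matrix.of fun i j : Fin (q + 1) =>
        (Fin.cons (e i) (fun j : Fin q => h i j) : Fin (q + 1) → R) j := by
      ext i j
      exact congrFun (hcons i) j
    rw [hM, Matrix.det_cons_column (fun i (j : Fin q) => h i j) e c fun i hi => he i (by omega)]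
    cases q with
    | zero =>
      rw [binomialDet_succ]
      simp [e, a, binomialEntry_one_zero]
    | succ q =>
      rw [hrec]
      simp [e, mul_assoc]
  have d₅ : (M.submatrix Fin.succ Fin.castSucc).det =
      (-1) ^ q * binomialDet t (κ + 2) (n + 2) q := by
    have hM : M.submatrix Fin.succ Fin.castSucc = Matrix.of fun i j : Fin (q + 1) =>
        (Fin.cons (e (i + 1)) (fun j : Fin q => h (i + 1) j) : Fin (q + 1) → R) j := by
      ext i j
      exact congrFun (hcons (i + 1)) j
    rw [hM, Matrix.det_cons_column (fun i (j : Fin q) => h (i + 1) j) (fun i => e (i + 1))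
      (fun i => c (i + 1)) fun i hi => he (i + 1) (by omega), binomialDet_add_two_add_two]
    simp [e, h, c, a]
  have d₆ : (M.submatrix Fin.castSucc Fin.succ).det = -binomialDet t κ n (q + 2) := by
    have : binomialDet t κ n (q + 2) = -(Matrix.of fun i j : Fin (q + 1) => h i j).det :=
      Matrix.det_eliminate_first_column a10 a0 (fun _ => rfl) fun _ _ => rfl
    rw [this, neg_neg]
    rfl
  have key := M.desnanot_jacobi
  rw [d₁, d₂, d₃, d₄, d₅, d₆] at key
  have hs : ((-1 : R) ^ q) * (-1) ^ q = 1 := by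
    rw [← mul_pow]
    simp
  linear_combination (-1) ^ q * key -
    (binomialDet t κ (n + 1) (q + 2) * binomialDet t (κ + 2) (n + 1) q -
      binomialDet t (κ + 2) (n + 2) q * binomialDet t κ n (q + 2) -
        t * (binomialDet t κ (n + 1) (q + 1) * binomialDet t (κ + 2) (n + 1) (q + 1))) * hs

end Entries

theorem intChoose_natCast (a b : ℕ) : intChoose a b = a.choose b := by
  simp [intChoose]

theorem sum_choose_eq_binomialEntry (κ n p i j : ℕ) (hj : j < p) :
    ∑ r ∈ Finset.range (2 * p + 1),
      Polynomial.C (intChoose ((i : ℤ) + 1 + ((κ : ℤ) + 1) - 1) ((r : ℤ) - ((i : ℤ) + 1)) *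
          intChoose (((j : ℤ) + 1) + n) (2 * ((j : ℤ) + 1) - (r : ℤ))) *
        Polynomial.X ^ (2 * (2 * ((j : ℤ) + 1) - (r : ℤ))).toNat =
      binomialEntry (X ^ 2 : ℤ[X]) κ n i j := by
  have hsub : Finset.range (2 * (j + 1) + 1) ⊆ Finset.range (2 * p + 1) :=
    Finset.range_subset_range.2 (by omega)
  rw [← Finset.sum_subset hsub, binomialEntry, coeff_mul,
    Finset.Nat.sum_antidiagonal_eq_sum_range_succ_mk]
  · refine Finset.sum_congr rfl fun r hr => ?_
    have hr' : r ≤ 2 * (j + 1) := by simpa [Nat.lt_succ_iff] using hr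
    have h₁ : (1 + C (X ^ 2) * X : ℤ[X][X]) ^ (j + 1 + n) =
        ((1 + X) ^ (j + 1 + n) : ℤ[X][X]).comp (C (X ^ 2) * X) := by simp
    rw [h₁, comp_C_mul_X_coeff, coeff_one_add_X_pow, coeff_X_pow_mul', coeff_one_add_X_pow]
    have e₁ : (2 * ((j : ℤ) + 1) - r) = ((2 * (j + 1) - r : ℕ) : ℤ) := by omega
    have e₂ : (j : ℤ) + 1 + n = ((j + 1 + n : ℕ) : ℤ) := by push_cast; ring
    have e₃ : (i : ℤ) + 1 + (κ + 1) - 1 = ((i + 1 + κ : ℕ) : ℤ) := by push_cast; ring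
    have e₄ : (2 * ((2 * (j + 1) - r : ℕ) : ℤ)).toNat = 2 * (2 * (j + 1) - r) := by omega
    rw [e₁, e₂, e₃, e₄]
    by_cases hi : i + 1 ≤ r
    · have e₅ : (r : ℤ) - (i + 1) = ((r - (i + 1) : ℕ) : ℤ) := by omega
      rw [e₅, if_pos hi, intChoose_natCast, intChoose_natCast, ← pow_mul]
      simp only [map_mul, map_natCast]
      ring
    · have e₅ : ¬ (0 : ℤ) ≤ (r : ℤ) - (i + 1) := by omega
      rw [if_neg hi]
      simp only [intChoose, if_neg e₅]
      simp
  · intro r _ hr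
    have : ¬ (0 : ℤ) ≤ 2 * ((j : ℤ) + 1) - r := by
      simp at hr
      omega
    simp only [intChoose, if_neg this]
    simp

theorem Tpoly_eq_binomialDet {L p k : ℤ} (κ n q : ℕ) (hk : k = κ + 1) (hp : p = q)
    (hL : L = n + 2 * p + k) : Tpoly L p k = binomialDet (X ^ 2) κ n q := by
  subst hL hk hp
  unfold Tpoly binomialDet
  rw [Int.toNat_natCast]
  congr 1
  ext1 i j
  rw [Matrix.of_apply, Matrix.of_apply, ← sum_choose_eq_binomialEntry κ n q i j j.isLt]
  have : (j : ℤ) + 1 + (n + 2 * q + (κ + 1)) - 2 * q - (κ + 1) = (j : ℤ) + 1 + n := by ring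
  rw [this]

/-- The bilinear recurrence (discrete Hirota equation) for the polynomials `T(L,p,k)`. -/
theorem Tpoly_bilinear_recurrence (L p k : ℤ) (hp : 2 ≤ p) (hk : 1 ≤ k)
    (hL : 1 ≤ L - 2 * p - k) :
    Tpoly L p k * Tpoly (L - 2) (p - 2) (k + 2) =
      Tpoly (L - 1) (p - 2) (k + 2) * Tpoly (L - 1) p k +
        Polynomial.X ^ 2 * (Tpoly (L - 2) (p - 1) k * Tpoly L (p - 1) (k + 2)) := by
  obtain ⟨q, hq⟩ := Int.eq_ofNat_of_zero_le (sub_nonneg.2 hp)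
  obtain ⟨κ, hκ⟩ := Int.eq_ofNat_of_zero_le (sub_nonneg.2 hk)
  obtain ⟨n, hn⟩ := Int.eq_ofNat_of_zero_le (sub_nonneg.2 hL)
  rw [Tpoly_eq_binomialDet κ (n + 1) (q + 2) (L := L) (k := k),
    Tpoly_eq_binomialDet (κ + 2) (n + 1) q (L := L - 2) (k := k + 2),
    Tpoly_eq_binomialDet (κ + 2) (n + 2) q (L := L - 1) (k := k + 2),
    Tpoly_eq_binomialDet κ n (q + 2) (L := L - 1) (k := k),
    Tpoly_eq_binomialDet κ (n + 1) (q + 1) (L := L - 2) (k := k),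
    Tpoly_eq_binomialDet (κ + 2) (n + 1) (q + 1) (L := L) (k := k + 2),
    binomialDet_bilinear_recurrence]
  all_goals push_cast; omega
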